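/- For every positive integer n, a composition c = (c_1,…,c_t) of n is a fixed point of the map U if and only if c_{2i-1} = 1 for every odd index 2i−1 ≤ t and c_{2i} is even for every even index 2i ≤ t. -/

import Mathlib

/-- A composition of `n`: a list of positive integers summing to `n`. -/
def IsComposition (n : ℕ) (l : List ℕ) : Prop :=
  (∀ x ∈ l, 0 < x) ∧ l.sum = n

/-- The image of one pair `(x, y)` of parts under the map `U`:
if `x > y` it becomes `(1^{x-y-1}, 2y+1)`; otherwise, with the unique `k ≥ 1`
such that `2k-2 ≤ y-x < 2k` (namely `k = (y-x)/2 + 1`), it becomes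
`(1^{x+y-2k}, 2k)`. -/
def Ustep (x y : ℕ) : List ℕ :=
  if y < x then List.replicate (x - y - 1) 1 ++ [2 * y + 1]
  else List.replicate (x + y - 2 * ((y - x) / 2 + 1)) 1 ++ [2 * ((y - x) / 2 + 1)]

/-- The map `U`: pair up consecutive parts (appending a final `0` when the
length is odd), apply `Ustep` to each pair, and concatenate. -/
def U : List ℕ → List ℕ
  | [] => []
  | [x] => Ustep x 0
  | x :: y :: rest => Ustep x y ++ U rest

theorem Ustep_one_of_even {y : ℕ} (hy : 0 < y) (he : Even y) : Ustep 1 y = [1, y] := by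
  obtain ⟨m, rfl⟩ := he
  have hk : 2 * ((m + m - 1) / 2 + 1) = m + m := by omega
  have hm : 1 + (m + m) - (m + m) = 1 := by omega
  rw [Ustep, if_neg (by omega), hk, hm]
  rfl

theorem eq_one_and_even_of_Ustep_append {x y : ℕ} {l r : List ℕ} (hx : 0 < x) (hy : 0 < y)
    (h : Ustep x y ++ l = x :: r) : x = 1 ∧ Even y := by
  unfold Ustep at h
  split_ifs at h with hlt
  · rcases hm : x - y - 1 with _ | m
    · simp only [hm, List.replicate_zero, List.nil_append, List.cons_append,
        List.cons.injEq] at h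
      omega
    · simp only [hm, List.replicate_succ, List.cons_append, List.cons.injEq] at h
      omega
  · rcases hm : x + y - 2 * ((y - x) / 2 + 1) with _ | m
    · simp only [hm, List.replicate_zero, List.nil_append, List.cons_append,
        List.cons.injEq] at h
      omega
    · simp only [hm, List.replicate_succ, List.cons_append, List.cons.injEq] at h
      refine ⟨h.1.symm, Nat.even_iff.mpr ?_⟩
      omega

theorem Ustep_append_eq_iff {x y : ℕ} {l r : List ℕ} (hx : 0 < x) (hy : 0 < y) :
    Ustep x y ++ l = x :: y :: r ↔ (x = 1 ∧ Even y) ∧ l = r := by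
  constructor
  · intro h
    obtain ⟨rfl, he⟩ := eq_one_and_even_of_Ustep_append hx hy h
    rw [Ustep_one_of_even hy he] at h
    exact ⟨⟨rfl, he⟩, by simpa using h⟩
  · rintro ⟨⟨rfl, he⟩, rfl⟩
    rw [Ustep_one_of_even hy he]
    rfl

theorem Ustep_zero_eq_singleton_iff {x : ℕ} (hx : 0 < x) : Ustep x 0 = [x] ↔ x = 1 := by
  rw [Ustep, if_pos hx]
  constructor
  · intro h
    have := congrArg List.length h
    simp only [List.length_append, List.length_replicate, List.length_singleton] at this
    omega
  · rintro rfl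
    rfl

theorem U_eq_self_iff_of_pos : ∀ c : List ℕ, (∀ x ∈ c, 0 < x) →
    (U c = c ↔
      (∀ i : ℕ, 2 * i < c.length → c.getD (2 * i) 0 = 1) ∧
      (∀ i : ℕ, 2 * i + 1 < c.length → Even (c.getD (2 * i + 1) 0)))
  | [], _ => by simp [U]
  | [x], hpos => by
    rw [U, Ustep_zero_eq_singleton_iff (hpos x (by simp))]
    constructor
    · rintro rfl
      refine ⟨fun i hi => ?_, fun i hi => ?_⟩
      · obtain rfl : i = 0 := by simp at hi; omega
        rfl
      · simp at hi
    · intro h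
      exact h.1 0 (by simp)
  | x :: y :: r, hpos => by
    rw [U, Ustep_append_eq_iff (hpos x (by simp)) (hpos y (by simp)),
      U_eq_self_iff_of_pos r fun z hz => hpos z (by simp [hz])]
    constructor
    · rintro ⟨⟨hx, hy⟩, hodd, heven⟩
      refine ⟨fun i hi => ?_, fun i hi => ?_⟩
      · cases i with
        | zero => exact hx
        | succ i => exact hodd i (by simp only [List.length_cons] at hi; omega)
      · cases i with
        | zero => exact hy
        | succ i => exact heven i (by simp only [List.length_cons] at hi; omega)
    · rintro ⟨hodd, heven⟩
      refine ⟨⟨hodd 0 (by simp), heven 0 (by simp)⟩, fun i hi => ?_, fun i hi => ?_⟩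
      · exact hodd (i + 1) (by simp only [List.length_cons]; omega)
      · exact heven (i + 1) (by simp only [List.length_cons]; omega)


/-- A composition of `n` is fixed by `U` iff every part in an odd position
(1-based; even position 0-based) equals `1` and every part in an even position
(1-based; odd position 0-based) is even. -/
theorem U_fixed_iff (n : ℕ) (hn : 0 < n) (c : List ℕ) (hc : IsComposition n c) :
    U c = c ↔
      (∀ i : ℕ, 2 * i < c.length → c.getD (2 * i) 0 = 1) ∧
      (∀ i : ℕ, 2 * i + 1 < c.length → Even (c.getD (2 * i + 1) 0)) :=
  U_eq_self_iff_of_pos c hc.1
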